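/- arXiv:math/0612647 — 3 statements merged into one kernel-verified Lean document; each statement's English description precedes it below -/
import Mathlib

section
/- Assume the boundary-symbol setup below with n ≥ 2. If a symmetric complex (n+1)×(n+1) matrix h satisfies equations (I), (II) and condition (III) (with some φ ∈ ℂ and real symmetric positive definite n×n matrix B), then φ · ⟨Bξ, ξ⟩ = φ · |ξ|² · tr B; consequently φ = 0 and h_{kl} = 0 for all k, l ∈ {1,…,n}. -/
open Matrix Complex

/-- The Euclidean norm `|ξ|` of a vector `ξ ∈ ℝⁿ`. -/
noncomputable def euclNorm {n : ℕ} (ξ : Fin n → ℝ) : ℝ :=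
  Real.sqrt (∑ k, ξ k ^ 2)

/-- The Lagrange-type identity expressing `2 (|ξ|² tr B - ⟨Bξ, ξ⟩)` as a sum of values of the
quadratic form of `B` at the vectors `ξ j • e i - ξ i • e j`. -/
theorem sum_dotProduct_mulVec_single_sub_single {ι : Type*} [Fintype ι] [DecidableEq ι]
    (B : Matrix ι ι ℝ) (hB : B.IsSymm) (ξ : ι → ℝ) :
    ∑ i, ∑ j, (Pi.single i (ξ j) - Pi.single j (ξ i)) ⬝ᵥ
        (B *ᵥ (Pi.single i (ξ j) - Pi.single j (ξ i)))
      = 2 * ((∑ k, ξ k ^ 2) * B.trace - ξ ⬝ᵥ (B *ᵥ ξ)) := by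
  have form_eq (i j : ι) : (Pi.single i (ξ j) - Pi.single j (ξ i)) ⬝ᵥ
      (B *ᵥ (Pi.single i (ξ j) - Pi.single j (ξ i)))
      = B i i * ξ j ^ 2 + ξ i ^ 2 * B j j - 2 * (ξ i * (B i j * ξ j)) := by
    simp only [Matrix.mulVec_sub, sub_dotProduct, dotProduct_sub, single_dotProduct,
      Matrix.mulVec_single, Pi.smul_apply, Matrix.col_apply, MulOpposite.smul_eq_mul_unop,
      MulOpposite.unop_op, hB.apply i j]
    ring
  simp only [form_eq]
  simp only [Finset.sum_sub_distrib, Finset.sum_add_distrib, ← Finset.mul_sum,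
    ← Finset.sum_mul, Matrix.trace, Matrix.diag_apply, dotProduct, Matrix.mulVec]
  ring

/-- In dimension at least two, every value of the Rayleigh quotient of a real positive definite
matrix is strictly smaller than its trace. -/
theorem Matrix.PosDef.dotProduct_mulVec_lt_sum_sq_mul_trace {ι : Type*} [Fintype ι] [Nontrivial ι]
    {B : Matrix ι ι ℝ} (hB : B.PosDef) {ξ : ι → ℝ} (hξ : ξ ≠ 0) :
    ξ ⬝ᵥ (B *ᵥ ξ) < (∑ k, ξ k ^ 2) * B.trace := by
  classical
  have hsymm : B.IsSymm := by simpa using hB.isHermitian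
  have form_nonneg (v : ι → ℝ) : 0 ≤ v ⬝ᵥ (B *ᵥ v) := by
    simpa using hB.posSemidef.dotProduct_mulVec_nonneg v
  obtain ⟨i, hi⟩ := Function.ne_iff.mp hξ
  obtain ⟨j, hj⟩ := exists_ne i
  have hne : (Pi.single i (ξ j) - Pi.single j (ξ i) : ι → ℝ) ≠ 0 := fun h0 => by
    have hval := congrFun h0 j
    simp [hj] at hval
    exact hi hval
  have form_pos := hB.dotProduct_mulVec_pos hne
  rw [star_trivial] at form_pos
  have sum_pos : 0 < ∑ i, ∑ j, (Pi.single i (ξ j) - Pi.single j (ξ i)) ⬝ᵥ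
      (B *ᵥ (Pi.single i (ξ j) - Pi.single j (ξ i))) :=
    Finset.sum_pos' (fun _ _ => Finset.sum_nonneg fun _ _ => form_nonneg _)
      ⟨i, Finset.mem_univ i, Finset.sum_pos' (fun _ _ => form_nonneg _)
        ⟨j, Finset.mem_univ j, form_pos⟩⟩
  rw [sum_dotProduct_mulVec_single_sub_single B hsymm ξ] at sum_pos
  linarith

/-- Boundary-symbol computation in the proof of Proposition 3.1:
if a symmetric complex `(n+1)×(n+1)` matrix `h` satisfies the Bianchi-gauge
boundary symbol equations (I), (II) at the root `z = i|ξ|`, and its tangential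
block is `φ·B` for a real symmetric positive definite `B` (III), then
`φ⟨Bξ,ξ⟩ = φ|ξ|² tr B`; consequently `φ = 0` and the tangential block of `h`
vanishes. Index `0 : Fin (n+1)` is the normal direction; `k.succ` for
`k : Fin n` are the tangential directions. -/
theorem symbol_tangential_block_vanishes
    (n : ℕ) (hn : 2 ≤ n)
    (ξ : Fin n → ℝ) (hξ : ξ ≠ 0)
    (h : Matrix (Fin (n + 1)) (Fin (n + 1)) ℂ) (hsymm : h.IsSymm)
    (φ : ℂ) (B : Matrix (Fin n) (Fin n) ℝ)
    (hBsymm : B.IsSymm) (hBpd : B.PosDef)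
    -- (I): for each tangential index k,
    -- 2|ξ| h₀ₖ − 2i ∑ⱼ ξⱼ hⱼₖ + i ξₖ tr h = 0
    (hI : ∀ k : Fin n,
      2 * (euclNorm ξ : ℂ) * h 0 k.succ
        - 2 * Complex.I * ∑ j : Fin n, (ξ j : ℂ) * h j.succ k.succ
        + Complex.I * (ξ k : ℂ) * Matrix.trace h = 0)
    -- (II): 2|ξ| h₀₀ − 2i ∑ₖ ξₖ h₀ₖ − |ξ| tr h = 0
    (hII : 2 * (euclNorm ξ : ℂ) * h 0 0
        - 2 * Complex.I * ∑ k : Fin n, (ξ k : ℂ) * h 0 k.succ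
        - (euclNorm ξ : ℂ) * Matrix.trace h = 0)
    -- (III): the tangential block of h equals φ·B
    (hIII : ∀ k l : Fin n, h k.succ l.succ = φ * (B k l : ℂ)) :
    φ * ((ξ ⬝ᵥ (B *ᵥ ξ) : ℝ) : ℂ)
        = φ * ((∑ k, ξ k ^ 2 : ℝ) : ℂ) * ((Matrix.trace B : ℝ) : ℂ)
      ∧ φ = 0 ∧ ∀ k l : Fin n, h k.succ l.succ = 0 := by
  have norm_sq : (euclNorm ξ : ℂ) ^ 2 = ((∑ k, ξ k ^ 2 : ℝ) : ℂ) := by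
    rw [← Complex.ofReal_pow, euclNorm, Real.sq_sqrt (Finset.sum_nonneg fun k _ => sq_nonneg _)]
  have trace_eq : h.trace = h 0 0 + φ * ((B.trace : ℝ) : ℂ) := by
    simp [Matrix.trace, Fin.sum_univ_succ, hIII, Finset.mul_sum]
  have form_eq : ∑ k, (ξ k : ℂ) * ∑ j, (ξ j : ℂ) * h j.succ k.succ
      = φ * ((ξ ⬝ᵥ (B *ᵥ ξ) : ℝ) : ℂ) := by
    simp only [hIII, dotProduct, Matrix.mulVec, Complex.ofReal_sum, Complex.ofReal_mul,
      Finset.mul_sum]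
    refine Finset.sum_congr rfl fun k _ => Finset.sum_congr rfl fun j _ => ?_
    rw [hBsymm.apply k j]
    ring
  have contracted : 2 * (euclNorm ξ : ℂ) * ∑ k, (ξ k : ℂ) * h 0 k.succ
      - 2 * Complex.I * (φ * ((ξ ⬝ᵥ (B *ᵥ ξ) : ℝ) : ℂ))
      + Complex.I * (euclNorm ξ : ℂ) ^ 2 * h.trace = 0 := by
    rw [← form_eq, norm_sq, Complex.ofReal_sum, Finset.mul_sum, Finset.mul_sum, Finset.mul_sum,
      Finset.sum_mul, ← Finset.sum_sub_distrib, ← Finset.sum_add_distrib]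
    refine Finset.sum_eq_zero fun k _ => ?_
    rw [Complex.ofReal_pow]
    linear_combination (ξ k : ℂ) * hI k
  have key : φ * ((ξ ⬝ᵥ (B *ᵥ ξ) : ℝ) : ℂ)
      = φ * ((∑ k, ξ k ^ 2 : ℝ) : ℂ) * ((Matrix.trace B : ℝ) : ℂ) := by
    rw [← norm_sq]
    linear_combination (1 / 2 : ℂ) * (euclNorm ξ : ℂ) * hII + (Complex.I / 2) * contracted
      + (euclNorm ξ : ℂ) ^ 2 * trace_eq
      + (φ * ((ξ ⬝ᵥ (B *ᵥ ξ) : ℝ) : ℂ) - (euclNorm ξ : ℂ) ^ 2 * h.trace / 2) * Complex.I_sq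
  have : Nontrivial (Fin n) := Fin.nontrivial_iff_two_le.mpr hn
  have hφ : φ = 0 := by
    by_contra hne
    rw [mul_assoc] at key
    exact (hBpd.dotProduct_mulVec_lt_sum_sq_mul_trace hξ).ne
      (by exact_mod_cast mul_left_cancel₀ hne key)
  exact ⟨key, hφ, fun k l => by rw [hIII, hφ, zero_mul]⟩
end

section
/- (Symbol-level ellipticity of the boundary value problem (3.6) of the paper.) Assume the boundary-symbol setup below with n ≥ 2. If a symmetric complex (n+1)×(n+1) matrix h satisfies equations (I), (II), condition (III) (with some φ ∈ ℂ and real symmetric positive definite n×n matrix B), and in addition h_{00} = 0, then h = 0, i.e., h_{αβ} = 0 for all α, β ∈ {0,1,…,n}. -/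
open Matrix Complex

/-- The quadratic form of a symmetric matrix at `a eᵢ - b eⱼ`. -/
lemma dotProduct_mulVec_single_sub_single {ι : Type*} [Fintype ι] [DecidableEq ι]
    {B : Matrix ι ι ℝ} (hB : B.IsSymm) (i j : ι) (a b : ℝ) :
    (Pi.single i a - Pi.single j b) ⬝ᵥ (B *ᵥ (Pi.single i a - Pi.single j b))
      = B i i * a ^ 2 + B j j * b ^ 2 - 2 * (B i j * (b * a)) := by
  have hij : B j i = B i j := hB.apply i j
  simp only [Matrix.mulVec_sub, sub_dotProduct, dotProduct_sub, single_dotProduct,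
    Matrix.mulVec_single, Pi.smul_apply, Matrix.col_apply, MulOpposite.smul_eq_mul_unop,
    MulOpposite.unop_op, hij]
  ring

/-- In dimension at least two, a positive definite matrix is strictly dominated by its trace. -/
lemma Matrix.PosDef.dotProduct_mulVec_lt_trace_mul {ι : Type*} [Fintype ι] [Nontrivial ι]
    {B : Matrix ι ι ℝ} (hB : B.PosDef) {x : ι → ℝ} (hx : x ≠ 0) :
    x ⬝ᵥ (B *ᵥ x) < B.trace * ∑ k, x k ^ 2 := by
  classical
  have hsymm : B.IsSymm := by simpa using hB.isHermitian
  let v : ι → ι → ι → ℝ := fun i j => Pi.single i (x j) - Pi.single j (x i)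
  have key : 2 * (B.trace * ∑ k, x k ^ 2 - x ⬝ᵥ (B *ᵥ x))
      = ∑ i, ∑ j, v i j ⬝ᵥ (B *ᵥ v i j) := by
    have hQ : x ⬝ᵥ (B *ᵥ x) = ∑ i, ∑ j, B i j * (x i * x j) := by
      simp only [dotProduct, Matrix.mulVec, Finset.mul_sum]
      exact Finset.sum_congr rfl fun i _ => Finset.sum_congr rfl fun j _ => by ring
    have hT : B.trace * ∑ k, x k ^ 2 = ∑ i, ∑ j, B i i * x j ^ 2 := by
      simp only [Matrix.trace, Matrix.diag_apply, Finset.sum_mul_sum]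
    have hT' : B.trace * ∑ k, x k ^ 2 = ∑ i, ∑ j, B j j * x i ^ 2 := by
      rw [hT, Finset.sum_comm]
    simp only [v, dotProduct_mulVec_single_sub_single hsymm, Finset.sum_sub_distrib,
      Finset.sum_add_distrib, ← Finset.mul_sum _ _ (2 : ℝ)]
    rw [← hQ, ← hT, ← hT']
    ring
  have hnonneg : ∀ i j, 0 ≤ v i j ⬝ᵥ (B *ᵥ v i j) := fun i j => by
    simpa using hB.posSemidef.dotProduct_mulVec_nonneg (v i j)
  obtain ⟨j, hj⟩ := Function.ne_iff.mp hx
  obtain ⟨i, hi⟩ := exists_ne j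
  have hv : v i j ≠ 0 := fun h0 => hj (by simpa [v, hi] using congrFun h0 i)
  have hpos : 0 < v i j ⬝ᵥ (B *ᵥ v i j) := by
    simpa using hB.dotProduct_mulVec_pos hv
  have hsum : 0 < ∑ i, ∑ j, v i j ⬝ᵥ (B *ᵥ v i j) :=
    Finset.sum_pos' (fun i _ => Finset.sum_nonneg fun j _ => hnonneg i j)
      ⟨i, Finset.mem_univ i, Finset.sum_pos' (fun j _ => hnonneg i j)
        ⟨j, Finset.mem_univ j, hpos⟩⟩
  linarith

lemma euclNorm_sq {n : ℕ} (ξ : Fin n → ℝ) : euclNorm ξ ^ 2 = ∑ k, ξ k ^ 2 :=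
  Real.sq_sqrt (Finset.sum_nonneg fun k _ => sq_nonneg (ξ k))

lemma euclNorm_ne_zero {n : ℕ} {ξ : Fin n → ℝ} (hξ : ξ ≠ 0) : euclNorm ξ ≠ 0 := by
  intro h0
  have hsum : ∑ k, ξ k ^ 2 = 0 := by rw [← euclNorm_sq, h0]; simp
  rw [Finset.sum_eq_zero_iff_of_nonneg fun k _ => sq_nonneg (ξ k)] at hsum
  exact hξ (funext fun k => by simpa using hsum k (Finset.mem_univ k))

/-- Symbol-level ellipticity of the boundary value problem (3.6) of the paper:
if a symmetric complex `(n+1)×(n+1)` matrix `h` satisfies the Bianchi-gauge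
boundary symbol equations (I), (II) at the root `z = i|ξ|`, its tangential
block is `φ·B` for a real symmetric positive definite `B` (III), and the
gauge boundary symbol condition `h₀₀ = 0` holds, then `h = 0`.
Index `0 : Fin (n+1)` is the normal direction; `k.succ` for `k : Fin n`
are the tangential directions. -/
theorem symbol_ellipticity_gauge_bc
    (n : ℕ) (hn : 2 ≤ n)
    (ξ : Fin n → ℝ) (hξ : ξ ≠ 0)
    (h : Matrix (Fin (n + 1)) (Fin (n + 1)) ℂ) (hsymm : h.IsSymm)
    (φ : ℂ) (B : Matrix (Fin n) (Fin n) ℝ)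
    (hBsymm : B.IsSymm) (hBpd : B.PosDef)
    -- (I): for each tangential index k,
    -- 2|ξ| h₀ₖ − 2i ∑ⱼ ξⱼ hⱼₖ + i ξₖ tr h = 0
    (hI : ∀ k : Fin n,
      2 * (euclNorm ξ : ℂ) * h 0 k.succ
        - 2 * Complex.I * ∑ j : Fin n, (ξ j : ℂ) * h j.succ k.succ
        + Complex.I * (ξ k : ℂ) * Matrix.trace h = 0)
    -- (II): 2|ξ| h₀₀ − 2i ∑ₖ ξₖ h₀ₖ − |ξ| tr h = 0
    (hII : 2 * (euclNorm ξ : ℂ) * h 0 0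
        - 2 * Complex.I * ∑ k : Fin n, (ξ k : ℂ) * h 0 k.succ
        - (euclNorm ξ : ℂ) * Matrix.trace h = 0)
    -- (III): the tangential block of h equals φ·B
    (hIII : ∀ k l : Fin n, h k.succ l.succ = φ * (B k l : ℂ))
    -- symbol of the gauge boundary condition g(Ñ,Ñ) = γ₀₀
    (h00 : h 0 0 = 0) :
    h = 0 := by
  have : Nontrivial (Fin n) := Fin.nontrivial_iff_two_le.mpr hn
  have hN : (euclNorm ξ : ℂ) ≠ 0 := by exact_mod_cast euclNorm_ne_zero hξ
  have hNsq : (euclNorm ξ : ℂ) ^ 2 = ∑ k, (ξ k : ℂ) ^ 2 := by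
    exact_mod_cast congrArg (fun r : ℝ => (r : ℂ)) (euclNorm_sq ξ)
  have hT : h.trace = φ * (B.trace : ℂ) := by
    simp [Matrix.trace, Fin.sum_univ_succ, h00, hIII, Finset.mul_sum]
  have hQ : ∑ k, (ξ k : ℂ) * ∑ j, (ξ j : ℂ) * h j.succ k.succ
      = φ * ((ξ ⬝ᵥ (B *ᵥ ξ) : ℝ) : ℂ) := by
    simp only [dotProduct, Matrix.mulVec, hIII, Complex.ofReal_sum, Complex.ofReal_mul,
      Finset.mul_sum]
    refine Finset.sum_congr rfl fun k _ => Finset.sum_congr rfl fun j _ => ?_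
    rw [hBsymm.apply k j]
    ring
  -- Contracting (I) with `ξ` and eliminating `∑ ξₖ h₀ₖ` by (II).
  have hcontr : 2 * (euclNorm ξ : ℂ) * ∑ k, (ξ k : ℂ) * h 0 k.succ
      - 2 * Complex.I * (φ * ((ξ ⬝ᵥ (B *ᵥ ξ) : ℝ) : ℂ))
      + Complex.I * (euclNorm ξ : ℂ) ^ 2 * h.trace = 0 := by
    rw [← hQ, hNsq, Finset.mul_sum, Finset.mul_sum, Finset.mul_sum, Finset.sum_mul,
      ← Finset.sum_sub_distrib, ← Finset.sum_add_distrib]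
    refine Finset.sum_eq_zero fun k _ => ?_
    linear_combination (ξ k : ℂ) * hI k
  have hφ : φ = 0 := by
    have hgap : ((B.trace * ∑ k, ξ k ^ 2 - ξ ⬝ᵥ (B *ᵥ ξ) : ℝ) : ℂ) ≠ 0 := by
      exact_mod_cast (sub_pos.mpr (hBpd.dotProduct_mulVec_lt_trace_mul hξ)).ne'
    refine (mul_eq_zero.mp ?_).resolve_right hgap
    rw [← euclNorm_sq]
    push_cast
    rw [h00] at hII
    rw [hT] at hII hcontr
    linear_combination (-Complex.I / 2) * hcontr - (euclNorm ξ : ℂ) / 2 * hII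
      + φ * ((euclNorm ξ : ℂ) ^ 2 * (B.trace : ℂ) / 2
        - ((ξ ⬝ᵥ (B *ᵥ ξ) : ℝ) : ℂ)) * Complex.I_sq
  have hnormal : ∀ k : Fin n, h 0 k.succ = 0 := fun k => by
    simpa [hIII, hT, hφ, hN] using hI k
  ext a b
  refine Fin.cases ?_ (fun k => ?_) a <;> refine Fin.cases ?_ (fun l => ?_) b
  · exact h00
  · exact hnormal l
  · rw [hsymm.apply 0 k.succ]
    exact hnormal k
  · simp [hIII, hφ]
end

section
/- (Symbol-level ellipticity of the boundary value problem (3.7) of the paper.) Assume the boundary-symbol setup below with n ≥ 2. If a symmetric complex (n+1)×(n+1) matrix h satisfies equations (I), (II), condition (III) (with some φ ∈ ℂ and real symmetric positive definite n×n matrix B), and in addition the mean-curvature symbol condition (IV), then h = 0, i.e., h_{αβ} = 0 for all α, β ∈ {0,1,…,n}. -/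
open Matrix Complex

/-- For a positive definite matrix in dimension at least two, the quadratic form at a nonzero
vector is strictly smaller than the trace times the squared Euclidean norm. -/
theorem Matrix.PosDef.quadratic_form_lt_trace_mul {ι : Type*} [Fintype ι] [Nontrivial ι]
    {B : Matrix ι ι ℝ} (hB : B.PosDef) {ξ : ι → ℝ} (hξ : ξ ≠ 0) :
    ∑ k, ∑ l, ξ k * ξ l * B k l < (∑ k, ξ k ^ 2) * ∑ k, B k k := by
  classical
  let w : ι → ι → ι → ℝ := fun k l => Pi.single l (ξ k) - Pi.single k (ξ l)
  have hsymm : ∀ k l, B k l = B l k := fun k l => by simpa using hB.isHermitian.apply l k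
  have hw : ∀ k l, w k l ⬝ᵥ (B *ᵥ w k l) =
      ξ k ^ 2 * B l l + ξ l ^ 2 * B k k - 2 * (ξ k * ξ l * B k l) := fun k l => by
    simp only [w, mulVec_sub, sub_dotProduct, dotProduct_sub, single_dotProduct, mulVec_single,
      Pi.smul_apply, col_apply, MulOpposite.smul_eq_mul_unop, MulOpposite.unop_op]
    rw [hsymm l k]
    ring
  have hpos : ∀ k l, w k l ≠ 0 → 0 < w k l ⬝ᵥ (B *ᵥ w k l) := fun k l hkl => by
    simpa using hB.dotProduct_mulVec_pos hkl
  have hnonneg : ∀ k l, 0 ≤ w k l ⬝ᵥ (B *ᵥ w k l) := fun k l => by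
    simpa using hB.posSemidef.dotProduct_mulVec_nonneg (w k l)
  obtain ⟨k, hk⟩ := Function.ne_iff.mp hξ
  obtain ⟨l, hl⟩ := exists_ne k
  have hwkl : w k l ≠ 0 := fun h0 => hk (by simpa [w, hl] using congrFun h0 l)
  have hsum : 0 < ∑ k, ∑ l, w k l ⬝ᵥ (B *ᵥ w k l) :=
    Finset.sum_pos' (fun k _ => Finset.sum_nonneg fun l _ => hnonneg k l)
      ⟨k, Finset.mem_univ k, Finset.sum_pos' (fun l _ => hnonneg k l)
        ⟨l, Finset.mem_univ l, hpos k l hwkl⟩⟩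
  simp only [hw, Finset.sum_sub_distrib, Finset.sum_add_distrib, ← Finset.mul_sum,
    ← Finset.sum_mul] at hsum
  linarith

/-- Symbol-level ellipticity of the boundary value problem (3.7) of the paper:
if a symmetric complex `(n+1)×(n+1)` matrix `h` satisfies the Bianchi-gauge
boundary symbol equations (I), (II) at the root `z = i|ξ|`, its tangential
block is `φ·B` for a real symmetric positive definite `B` (III), and the
mean-curvature boundary symbol condition (IV) holds, then `h = 0`.
Index `0 : Fin (n+1)` is the normal direction; `k.succ` for `k : Fin n`
are the tangential directions. -/
theorem symbol_ellipticity_mean_curvature_bc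
    (n : ℕ) (hn : 2 ≤ n)
    (ξ : Fin n → ℝ) (hξ : ξ ≠ 0)
    (h : Matrix (Fin (n + 1)) (Fin (n + 1)) ℂ) (hsymm : h.IsSymm)
    (φ : ℂ) (B : Matrix (Fin n) (Fin n) ℝ)
    (hBsymm : B.IsSymm) (hBpd : B.PosDef)
    -- (I): for each tangential index k,
    -- 2|ξ| h₀ₖ − 2i ∑ⱼ ξⱼ hⱼₖ + i ξₖ tr h = 0
    (hI : ∀ k : Fin n,
      2 * (euclNorm ξ : ℂ) * h 0 k.succ
        - 2 * Complex.I * ∑ j : Fin n, (ξ j : ℂ) * h j.succ k.succ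
        + Complex.I * (ξ k : ℂ) * Matrix.trace h = 0)
    -- (II): 2|ξ| h₀₀ − 2i ∑ₖ ξₖ h₀ₖ − |ξ| tr h = 0
    (hII : 2 * (euclNorm ξ : ℂ) * h 0 0
        - 2 * Complex.I * ∑ k : Fin n, (ξ k : ℂ) * h 0 k.succ
        - (euclNorm ξ : ℂ) * Matrix.trace h = 0)
    -- (III): the tangential block of h equals φ·B
    (hIII : ∀ k l : Fin n, h k.succ l.succ = φ * (B k l : ℂ))
    -- (IV): mean-curvature symbol at the root z = i|ξ|:
    -- −|ξ| ∑ₖ hₖₖ − 2i ∑ₖ ξₖ h₀ₖ = 0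
    (hIV : -(euclNorm ξ : ℂ) * ∑ k : Fin n, h k.succ k.succ
        - 2 * Complex.I * ∑ k : Fin n, (ξ k : ℂ) * h 0 k.succ = 0) :
    h = 0 := by
  have : Nontrivial (Fin n) := Fin.nontrivial_iff_two_le.mpr hn
  have hsq : 0 < ∑ k, ξ k ^ 2 := by
    obtain ⟨k, hk⟩ := Function.ne_iff.mp hξ
    exact Finset.sum_pos' (fun k _ => sq_nonneg (ξ k))
      ⟨k, Finset.mem_univ k, sq_pos_of_ne_zero hk⟩
  have hN : (euclNorm ξ : ℂ) ≠ 0 := by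
    exact_mod_cast (Real.sqrt_pos.mpr hsq).ne'
  have hNsq : (euclNorm ξ : ℂ) ^ 2 = ∑ k, (ξ k : ℂ) ^ 2 := by
    exact_mod_cast Real.sq_sqrt hsq.le
  have htr : h.trace = h 0 0 + ∑ k : Fin n, h k.succ k.succ := by
    simp [Matrix.trace, Fin.sum_univ_succ]
  have hT : ∑ k : Fin n, h k.succ k.succ = φ * ∑ k, (B k k : ℂ) := by
    simp only [hIII, Finset.mul_sum]
  rw [htr] at hII
  have h00 : h 0 0 = 0 := by
    refine (mul_eq_zero.mp ?_).resolve_left hN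
    linear_combination hII - hIV
  rw [htr, h00, zero_add] at hI
  -- Contract the tangential gauge equations with `ξ`.
  have hcontr : 2 * (euclNorm ξ : ℂ) * ∑ k : Fin n, (ξ k : ℂ) * h 0 k.succ
      - 2 * Complex.I * (φ * ∑ k, ∑ j, (ξ k : ℂ) * ξ j * B k j)
      + Complex.I * (∑ k, (ξ k : ℂ) ^ 2) * ∑ k : Fin n, h k.succ k.succ = 0 := by
    have hinner : ∀ k, ∑ j, (ξ k : ℂ) * ξ j * B k j * φ
        = ξ k * ∑ j : Fin n, (ξ j : ℂ) * h j.succ k.succ := fun k => by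
      rw [Finset.mul_sum]
      refine Finset.sum_congr rfl fun j _ => ?_
      rw [hIII, hBsymm.apply k j]
      ring
    rw [mul_comm φ, Finset.sum_mul]
    simp only [Finset.sum_mul _ _ φ, hinner]
    rw [Finset.mul_sum, Finset.mul_sum, Finset.mul_sum _ _ Complex.I, Finset.sum_mul,
      ← Finset.sum_sub_distrib, ← Finset.sum_add_distrib]
    refine Finset.sum_eq_zero fun k _ => ?_
    linear_combination (ξ k : ℂ) * hI k
  have hφ : φ = 0 := by
    have hlt := hBpd.quadratic_form_lt_trace_mul hξ
    have hne : (∑ k, (ξ k : ℂ) ^ 2) * ∑ k, (B k k : ℂ)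
        - ∑ k, ∑ j, (ξ k : ℂ) * ξ j * B k j ≠ 0 := by
      exact_mod_cast (sub_pos.mpr hlt).ne'
    refine (mul_eq_zero.mp ?_).resolve_right hne
    rw [hT] at hcontr hIV
    linear_combination -(Complex.I / 2) * hcontr - (euclNorm ξ : ℂ) / 2 * hIV
      - (φ * ∑ k, (B k k : ℂ)) / 2 * hNsq
      + ((∑ k, (ξ k : ℂ) ^ 2) * φ * (∑ k, (B k k : ℂ)) / 2
        - φ * ∑ k, ∑ j, (ξ k : ℂ) * ξ j * B k j) * Complex.I_sq
  have hblock : ∀ k l : Fin n, h k.succ l.succ = 0 := fun k l => by simp [hIII, hφ]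
  have hrow : ∀ k : Fin n, h 0 k.succ = 0 := fun k => by
    have hk := hI k
    simpa [hblock, hN] using hk
  ext a b
  refine Fin.cases ?_ (fun k => ?_) a <;> refine Fin.cases ?_ (fun l => ?_) b
  · exact h00
  · exact hrow l
  · rw [hsymm.apply]
    exact hrow k
  · exact hblock k l
end
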